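/- Let U ⊂ V be a 2-dimensional ℂ-linear subspace with U ∩ U^⊥ = 0, and let p ≠ 0 span U^⊥ (so ⟨p,p⟩ ≠ 0). Then W_U := {h : V → V ℂ-linear | tr h = 0, h* = h, h(U) ⊆ U^⊥} satisfies: dim_ℝ W_U = 4, every nonzero h ∈ W_U has rank exactly 2, and the base of W_U equals ℙ(U) ∪ {[p]}, i.e., {[v] ∈ ℙ(V) | ⟨h v, v⟩ = 0 for all h ∈ W_U} = ℙ(U) ∪ {[p]}. -/

import Mathlib

open scoped ComplexConjugate

noncomputable section

/-- `V` is `ℂ³`. -/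
abbrev V3 : Type := Fin 3 → ℂ

/-- The hermitian form of signature `(2,1)`:
`⟨x,y⟩ = x₀·conj y₀ + x₁·conj y₁ − x₂·conj y₂`. -/
def herm (x y : V3) : ℂ := x 0 * conj (y 0) + x 1 * conj (y 1) - x 2 * conj (y 2)

/-- The complex projective plane `ℙ(V)`. -/
abbrev PV : Type := Projectivization ℂ V3

/-- The class `[v]` of a nonzero vector `v` in `ℙ(V)`. -/
def projMk (v : V3) (hv : v ≠ 0) : PV := Projectivization.mk ℂ v hv

/-- A map `h` is self-adjoint (`h* = h`) w.r.t. the hermitian form. -/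
def SelfAdj (h : Module.End ℂ V3) : Prop := ∀ x y : V3, herm (h x) y = herm x (h y)

/-- The set `B_h = {[v] ∈ ℙ(V) | ⟨h v, v⟩ = 0}`. -/
def Bset (h : Module.End ℂ V3) : Set PV :=
  {q | ∃ v : V3, ∃ hv : v ≠ 0, q = projMk v hv ∧ herm (h v) v = 0}

/-- `h` defines a bisector: self-adjoint, trace `0`, rank `2`, and `B_h` contains
a point other than the focus (i.e. a point `[v]` with `h v ≠ 0`). -/
def IsBisector (h : Module.End ℂ V3) : Prop :=
  SelfAdj h ∧ LinearMap.trace ℂ V3 h = 0 ∧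
    Module.finrank ℂ (LinearMap.range h) = 2 ∧ ∃ v : V3, herm (h v) v = 0 ∧ h v ≠ 0

/-- A linear family of bisectors: an `ℝ`-subspace of self-adjoint traceless
degenerate maps whose base contains a negative point. -/
def IsLinearFamily (W : Submodule ℝ (Module.End ℂ V3)) : Prop :=
  (∀ h ∈ W, SelfAdj h ∧ LinearMap.trace ℂ V3 h = 0 ∧ LinearMap.det h = 0) ∧
    ∃ v : V3, ∃ hv : v ≠ 0, (herm v v).re < 0 ∧ ∀ h ∈ W, herm (h v) v = 0

/-- The map `x ↦ ⟨x,p⟩·p`. -/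
def wmap (p : V3) : Module.End ℂ V3 where
  toFun x := herm x p • p
  map_add' x y := by
    show herm (x + y) p • p = herm x p • p + herm y p • p
    have : herm (x + y) p = herm x p + herm y p := by
      simp only [herm, Pi.add_apply]; ring
    rw [this, add_smul]
  map_smul' c x := by
    show herm (c • x) p • p = c • (herm x p • p)
    have : herm (c • x) p = c * herm x p := by
      simp only [herm, Pi.smul_apply, smul_eq_mul]; ring
    rw [this, mul_smul]

/-- `ℙ(U)` for a complex subspace `U`. -/
def projC (U : Submodule ℂ V3) : Set PV :=
  {q | ∃ v : V3, ∃ hv : v ≠ 0, v ∈ U ∧ q = projMk v hv}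

/-- `ℙ(T)` for a real subspace `T`. -/
def projR (T : Submodule ℝ V3) : Set PV :=
  {q | ∃ v : V3, ∃ hv : v ≠ 0, v ∈ T ∧ q = projMk v hv}

/-- An `ℝ`-plane: `ℙ(T)` for a totally real `3`-dimensional real subspace `T`
with `ℂ·T = V`. -/
def IsRealPlane (T : Submodule ℝ V3) : Prop :=
  Module.finrank ℝ T = 3 ∧ Submodule.span ℂ (T : Set V3) = ⊤ ∧
    ∀ t ∈ T, ∀ t' ∈ T, (herm t t').im = 0

/-- A geodesic: `ℙ(W₀)` for a `2`-dimensional real subspace `W₀` on which the form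
is real-valued and not identically zero. -/
def IsGeodesic (W₀ : Submodule ℝ V3) : Prop :=
  Module.finrank ℝ W₀ = 2 ∧ (∀ w ∈ W₀, ∀ w' ∈ W₀, (herm w w').im = 0) ∧
    ∃ w ∈ W₀, ∃ w' ∈ W₀, herm w w' ≠ 0

/-- The real spine `R = {[h v] | [v] ∈ B_h, h v ≠ 0}` of `B_h`. -/
def RealSpine (h : Module.End ℂ V3) : Set PV :=
  {q | ∃ v : V3, ∃ hnz : h v ≠ 0, herm (h v) v = 0 ∧ q = projMk (h v) hnz}

/-- The orthogonal complement w.r.t. the hermitian form. -/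
def hermOrth (U : Submodule ℂ V3) : Submodule ℂ V3 where
  carrier := {x | ∀ u ∈ U, herm x u = 0}
  add_mem' := by
    intro a b ha hb u hu
    have h1 : herm (a + b) u = herm a u + herm b u := by
      simp only [herm, Pi.add_apply]; ring
    rw [h1, ha u hu, hb u hu, add_zero]
  zero_mem' := by
    intro u hu
    simp [herm]
  smul_mem' := by
    intro c x hx u hu
    have h1 : herm (c • x) u = c * herm x u := by
      simp only [herm, Pi.smul_apply, smul_eq_mul]; ring
    rw [h1, hx u hu, mul_zero]


lemma herm_add_left (x y z : V3) : herm (x + y) z = herm x z + herm y z := by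
  simp only [herm, Pi.add_apply]; ring

lemma herm_smul_left (c : ℂ) (x y : V3) : herm (c • x) y = c * herm x y := by
  simp only [herm, Pi.smul_apply, smul_eq_mul]; ring

lemma conj_herm (x y : V3) : conj (herm x y) = herm y x := by
  simp only [herm, map_sub, map_add, map_mul, Complex.conj_conj]; ring

lemma herm_add_right (x y z : V3) : herm x (y + z) = herm x y + herm x z := by
  simp only [herm, Pi.add_apply, map_add]; ring

lemma herm_smul_right (c : ℂ) (x y : V3) : herm x (c • y) = conj c * herm x y := by
  simp only [herm, Pi.smul_apply, smul_eq_mul, map_mul]; ring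

/-- The linear functional `x ↦ ⟨x, y⟩`. -/
def hermFun (y : V3) : V3 →ₗ[ℂ] ℂ where
  toFun x := herm x y
  map_add' x z := herm_add_left x z y
  map_smul' c x := herm_smul_left c x y

/-- The map `x ↦ (⟨x, w⟩ p + ⟨x, p⟩ w) / ⟨p, p⟩`. -/
def swapMap (p w : V3) : Module.End ℂ V3 :=
  (herm p p)⁻¹ • ((hermFun w).smulRight p + (hermFun p).smulRight w)

lemma swapMap_apply (p w x : V3) :
    swapMap p w x = (herm p p)⁻¹ • (herm x w • p + herm x p • w) := rfl

lemma selfAdj_swapMap (p w : V3) : SelfAdj (swapMap p w) := by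
  intro x y
  simp only [swapMap_apply, herm_add_left, herm_smul_left, herm_add_right, herm_smul_right,
    map_inv₀, conj_herm]
  ring

lemma trace_swapMap {p w : V3} (hw : herm w p = 0) :
    LinearMap.trace ℂ V3 (swapMap p w) = 0 := by
  have hw' : herm p w = 0 := by rw [← conj_herm, hw, map_zero]
  simp [swapMap, LinearMap.trace_smulRight, hermFun, hw, hw']

lemma swapMap_apply_self {p w : V3} (hpp : herm p p ≠ 0) (hw : herm w p = 0) :
    swapMap p w p = w := by
  have hw' : herm p w = 0 := by rw [← conj_herm, hw, map_zero]
  rw [swapMap_apply, hw', zero_smul, zero_add, smul_smul, inv_mul_cancel₀ hpp, one_smul]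

section

variable {U : Submodule ℂ V3} {p : V3}

lemma herm_eq_zero_of_mem (hspan : hermOrth U = Submodule.span ℂ {p}) {u : V3} (hu : u ∈ U) :
    herm u p = 0 := by
  have h : p ∈ hermOrth U := hspan ▸ Submodule.mem_span_singleton_self p
  rw [← conj_herm, h u hu, map_zero]

lemma exists_add_smul_eq (hU2 : Module.finrank ℂ U = 2) (hnd : U ⊓ hermOrth U = ⊥)
    (hp0 : p ≠ 0) (hspan : hermOrth U = Submodule.span ℂ {p}) (x : V3) :
    ∃ u ∈ U, ∃ c : ℂ, u + c • p = x := by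
  have h := Submodule.finrank_sup_add_finrank_inf_eq U (hermOrth U)
  rw [hnd, finrank_bot, hU2, hspan, finrank_span_singleton hp0] at h
  have htop : U ⊔ Submodule.span ℂ {p} = ⊤ :=
    Submodule.eq_top_of_finrank_eq (by simpa using h)
  obtain ⟨u, hu, y, hy, hxy⟩ := Submodule.mem_sup.1 (htop ▸ Submodule.mem_top : x ∈ _)
  obtain ⟨c, rfl⟩ := Submodule.mem_span_singleton.1 hy
  exact ⟨u, hu, c, hxy⟩

lemma swapMap_apply_mem (hspan : hermOrth U = Submodule.span ℂ {p}) (w : V3) {u : V3}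
    (hu : u ∈ U) : swapMap p w u = ((herm p p)⁻¹ * herm u w) • p := by
  rw [swapMap_apply, herm_eq_zero_of_mem hspan hu, zero_smul, add_zero, smul_smul]

/-- The traceless self-adjoint maps sending `U` into its orthogonal complement are exactly
the maps `swapMap p w` with `w ∈ U`. -/
lemma exists_eq_swapMap_iff (hU2 : Module.finrank ℂ U = 2) (hnd : U ⊓ hermOrth U = ⊥)
    (hp0 : p ≠ 0) (hspan : hermOrth U = Submodule.span ℂ {p}) (hpp : herm p p ≠ 0)
    (h : Module.End ℂ V3) :
    (LinearMap.trace ℂ V3 h = 0 ∧ SelfAdj h ∧ ∀ u ∈ U, h u ∈ hermOrth U) ↔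
      ∃ w ∈ U, h = swapMap p w := by
  constructor
  · rintro ⟨htr, hsa, hU⟩
    obtain ⟨w, hw, a, hwa⟩ := exists_add_smul_eq hU2 hnd hp0 hspan (h p)
    have hwp := herm_eq_zero_of_mem hspan hw
    have key : h = swapMap p w + (a * (herm p p)⁻¹) • (hermFun p).smulRight p := by
      refine LinearMap.ext fun x ↦ ?_
      obtain ⟨u, hu, c, rfl⟩ := exists_add_smul_eq hU2 hnd hp0 hspan x
      have hup := herm_eq_zero_of_mem hspan hu
      obtain ⟨b, hb⟩ := Submodule.mem_span_singleton.1 (hspan ▸ hU u hu)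
      have hbw : b * herm p p = herm u w := by
        rw [← herm_smul_left, hb, hsa, ← hwa, herm_add_right, herm_smul_right, hup, mul_zero,
          add_zero]
      have hb' : b = (herm p p)⁻¹ * herm u w := by rw [← hbw]; field_simp
      have hp' : a * (herm p p)⁻¹ * herm p p = a := by field_simp
      have hhu : hermFun p u = 0 := hup
      have hhp : hermFun p p = herm p p := rfl
      rw [map_add, map_add, map_smul, map_smul, ← hb, ← hwa, LinearMap.add_apply,
        LinearMap.add_apply, swapMap_apply_mem hspan w hu, swapMap_apply_self hpp hwp, ← hb']
      simp only [LinearMap.smul_apply, LinearMap.smulRight_apply, hhu, hhp, smul_smul, hp',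
        zero_smul, smul_zero, add_zero]
    have ha : a = 0 := by
      rw [key, map_add, trace_swapMap hwp, map_smul, LinearMap.trace_smulRight] at htr
      have hhp : hermFun p p = herm p p := rfl
      simpa [hhp, hpp] using htr
    exact ⟨w, hw, by simpa [ha] using key⟩
  · rintro ⟨w, hw, rfl⟩
    refine ⟨trace_swapMap (herm_eq_zero_of_mem hspan hw), selfAdj_swapMap p w, fun u hu ↦ ?_⟩
    rw [swapMap_apply_mem hspan w hu, hspan]
    exact Submodule.smul_mem _ _ (Submodule.mem_span_singleton_self p)

lemma eq_zero_of_forall_herm (hnd : U ⊓ hermOrth U = ⊥) {u : V3} (hu : u ∈ U)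
    (h : ∀ w ∈ U, herm u w = 0) : u = 0 := by
  have : u ∈ U ⊓ hermOrth U := ⟨hu, h⟩
  simpa [hnd] using this

lemma finrank_range_swapMap (hnd : U ⊓ hermOrth U = ⊥)
    (hspan : hermOrth U = Submodule.span ℂ {p}) (hpp : herm p p ≠ 0) {w : V3} (hw : w ∈ U)
    (hw0 : w ≠ 0) : Module.finrank ℂ (LinearMap.range (swapMap p w)) = 2 := by
  have hwp := herm_eq_zero_of_mem hspan hw
  have hrange : LinearMap.range (swapMap p w) = Submodule.span ℂ (Set.range ![p, w]) := by
    rw [Matrix.range_cons, Matrix.range_cons, Matrix.range_empty, Set.union_empty,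
      Set.singleton_union]
    apply le_antisymm
    · rintro _ ⟨x, rfl⟩
      exact Submodule.smul_mem _ _ (Submodule.mem_span_pair.2 ⟨_, _, rfl⟩)
    · obtain ⟨u, hu, huw⟩ : ∃ u ∈ U, herm w u ≠ 0 := by
        by_contra! hcon
        exact hw0 (eq_zero_of_forall_herm hnd hw hcon)
      have huw' : herm u w ≠ 0 := by
        rwa [← conj_herm, Ne, map_eq_zero]
      rw [Submodule.span_le, Set.insert_subset_iff, Set.singleton_subset_iff]
      refine ⟨⟨(herm p p * (herm u w)⁻¹) • u, ?_⟩, ⟨p, swapMap_apply_self hpp hwp⟩⟩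
      rw [map_smul, swapMap_apply_mem hspan w hu, smul_smul]
      convert one_smul ℂ p using 2
      field_simp
  have hli : LinearIndependent ℂ ![p, w] := by
    refine LinearIndependent.pair_iff.2 fun s t hst ↦ ?_
    have hs : s = 0 := by
      have h : herm (s • p + t • w) p = 0 := by rw [hst]; simp [herm]
      simpa [herm_add_left, herm_smul_left, hwp, hpp, -smul_eq_mul] using h
    subst hs
    simpa [hw0] using hst
  rw [hrange, finrank_span_eq_card hli, Fintype.card_fin]

lemma herm_swapMap_apply_add_smul (hspan : hermOrth U = Submodule.span ℂ {p})
    (hpp : herm p p ≠ 0) {w u : V3} (hw : w ∈ U) (hu : u ∈ U) (c : ℂ) :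
    herm (swapMap p w (u + c • p)) (u + c • p) = conj c * herm u w + c * herm w u := by
  have hwp := herm_eq_zero_of_mem hspan hw
  have hup := herm_eq_zero_of_mem hspan hu
  have hpu : herm p u = 0 := by rw [← conj_herm, hup, map_zero]
  rw [map_add, map_smul, swapMap_apply_mem hspan w hu, swapMap_apply_self hpp hwp]
  simp only [herm_add_left, herm_add_right, herm_smul_left, herm_smul_right, hwp, hpu]
  field_simp
  ring

lemma forall_herm_swapMap_eq_zero (hnd : U ⊓ hermOrth U = ⊥)
    (hspan : hermOrth U = Submodule.span ℂ {p}) (hpp : herm p p ≠ 0) {u : V3} (hu : u ∈ U)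
    (c : ℂ) : (∀ w ∈ U, herm (swapMap p w (u + c • p)) (u + c • p) = 0) ↔ c = 0 ∨ u = 0 := by
  constructor
  · intro h
    refine or_iff_not_imp_left.2 fun hc ↦ eq_zero_of_forall_herm hnd hu fun w hw ↦ ?_
    have hk : (conj c * herm u w) • w ∈ U := U.smul_mem _ hw
    have := h _ hk
    rw [herm_swapMap_apply_add_smul hspan hpp hk hu, herm_smul_right, herm_smul_left, map_mul,
      Complex.conj_conj, conj_herm] at this
    have h2 : 2 * (conj c * c * (herm u w * herm w u)) = 0 := by linear_combination this
    rw [← conj_herm u w] at h2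
    simpa [hc] using h2
  · rintro h w hw
    rw [herm_swapMap_apply_add_smul hspan hpp hw hu]
    rcases h with rfl | rfl <;> simp [herm]

end

/-- Lemma 4.4.2: for a nondegenerate `2`-dimensional `U` with polar point
`p`, the family `W_U` is `4`-dimensional, consists of rank-`2` maps, and has base
`ℙ(U) ∪ {[p]}`. -/
theorem stmt_9 (U : Submodule ℂ V3) (hU2 : Module.finrank ℂ U = 2)
    (hnd : U ⊓ hermOrth U = ⊥) (p : V3) (hp0 : p ≠ 0)
    (hspan : hermOrth U = Submodule.span ℂ {p}) (hpp : herm p p ≠ 0)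
    (W : Submodule ℝ (Module.End ℂ V3))
    (hWdef : ∀ h : Module.End ℂ V3, h ∈ W ↔
      (LinearMap.trace ℂ V3 h = 0 ∧ SelfAdj h ∧ ∀ u ∈ U, h u ∈ hermOrth U)) :
    Module.finrank ℝ W = 4 ∧
      (∀ h ∈ W, h ≠ 0 → Module.finrank ℂ (LinearMap.range h) = 2) ∧
      {q : PV | ∃ v : V3, ∃ hv : v ≠ 0, q = projMk v hv ∧ ∀ h ∈ W, herm (h v) v = 0}
        = projC U ∪ {projMk p hp0} := by
  simp only [exists_eq_swapMap_iff hU2 hnd hp0 hspan hpp] at hWdef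
  refine ⟨?_, ?_, ?_⟩
  · have hmem (h : W) : h.1 p ∈ U.restrictScalars ℝ := by
      obtain ⟨w, hw, hh⟩ := (hWdef h.1).1 h.2
      rw [hh, swapMap_apply_self hpp (herm_eq_zero_of_mem hspan hw)]
      exact hw
    let f : W →ₗ[ℝ] U.restrictScalars ℝ :=
      { toFun := fun h ↦ ⟨h.1 p, hmem h⟩
        map_add' := fun _ _ ↦ rfl
        map_smul' := fun _ _ ↦ rfl }
    have hf : Function.Bijective f := by
      constructor
      · rintro ⟨h, hh⟩ ⟨h', hh'⟩ heq
        obtain ⟨w, hw, rfl⟩ := (hWdef h).1 hh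
        obtain ⟨w', hw', rfl⟩ := (hWdef h').1 hh'
        have hww : swapMap p w p = swapMap p w' p := congrArg Subtype.val heq
        rw [swapMap_apply_self hpp (herm_eq_zero_of_mem hspan hw),
          swapMap_apply_self hpp (herm_eq_zero_of_mem hspan hw')] at hww
        subst hww
        rfl
      · rintro ⟨w, hw⟩
        exact ⟨⟨swapMap p w, (hWdef _).2 ⟨w, hw, rfl⟩⟩,
          Subtype.ext (swapMap_apply_self hpp (herm_eq_zero_of_mem hspan hw))⟩
    rw [(LinearEquiv.ofBijective f hf).finrank_eq]
    have h2 : Module.finrank ℝ U = 2 * Module.finrank ℂ U := finrank_real_of_complex U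
    rw [hU2] at h2
    exact h2
  · intro h hh h0
    obtain ⟨w, hw, rfl⟩ := (hWdef h).1 hh
    refine finrank_range_swapMap hnd hspan hpp hw ?_
    rintro rfl
    exact h0 (LinearMap.ext fun x ↦ by simp [swapMap_apply, herm])
  · have hbase {u : V3} (hu : u ∈ U) (c : ℂ) :
        (∀ h ∈ W, herm (h (u + c • p)) (u + c • p) = 0) ↔ c = 0 ∨ u = 0 := by
      rw [← forall_herm_swapMap_eq_zero hnd hspan hpp hu c]
      exact ⟨fun H w hw ↦ H _ ((hWdef _).2 ⟨w, hw, rfl⟩), fun H h hh ↦ by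
        obtain ⟨w, hw, rfl⟩ := (hWdef h).1 hh
        exact H w hw⟩
    ext q
    constructor
    · rintro ⟨v, hv, rfl, H⟩
      obtain ⟨u, hu, c, rfl⟩ := exists_add_smul_eq hU2 hnd hp0 hspan v
      rcases (hbase hu c).1 H with rfl | rfl
      · exact Or.inl ⟨_, hv, by simpa using hu, rfl⟩
      · exact Or.inr ((Projectivization.mk_eq_mk_iff' ℂ _ _ hv hp0).2 ⟨c, by simp⟩)
    · rintro (⟨v, hv, hvU, rfl⟩ | rfl)
      · exact ⟨v, hv, rfl, by simpa using (hbase hvU 0).2 (Or.inl rfl)⟩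
      · exact ⟨p, hp0, rfl, by simpa using (hbase U.zero_mem 1).2 (Or.inr rfl)⟩

end
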